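/- Let A be a DUP K-positive map. Then A is K-mixing if and only if dim Ker(A⊗A − I⊗I) = 1. -/

import Mathlib

open Filter Topology RealInnerProductSpace

variable {V : Type*} [NormedAddCommGroup V] [InnerProductSpace ℝ V] [FiniteDimensional ℝ V]

/-- The dual cone of a set `K`. -/
def dualSet (K : Set V) : Set V := {y | ∀ x ∈ K, 0 ≤ ⟪y, x⟫}

/-- The spectral radius via the Gelfand formula. -/
noncomputable def specRad (A : V →L[ℝ] V) : ℝ :=
  Filter.limsup (fun n : ℕ => ‖A ^ n‖ ^ ((n : ℝ)⁻¹)) Filter.atTop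

/-- `A` is `K`-ergodic with stationary vector `x₀` and dual stationary vector `y₀`. -/
def IsErgodicWith (K : Set V) (A : V →L[ℝ] V) (x₀ y₀ : V) : Prop :=
  0 < specRad A ∧ x₀ ∈ K ∧ y₀ ∈ dualSet K ∧ ⟪y₀, x₀⟫ = 1 ∧
    ∀ x : V, Tendsto
      (fun n : ℕ => (n : ℝ)⁻¹ • ∑ k ∈ Finset.range n, (((specRad A)⁻¹ • A) ^ k) x)
      atTop (𝓝 (⟪y₀, x⟫ • x₀))

/-- `A` is `K`-ergodic. -/
def IsErgodic (K : Set V) (A : V →L[ℝ] V) : Prop := ∃ x₀ y₀, IsErgodicWith K A x₀ y₀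

/-- `A` is `K`-mixing with stationary vector `x₀` and dual stationary vector `y₀`. -/
def IsMixingWith (K : Set V) (A : V →L[ℝ] V) (x₀ y₀ : V) : Prop :=
  0 < specRad A ∧ x₀ ∈ K ∧ y₀ ∈ dualSet K ∧ ⟪y₀, x₀⟫ = 1 ∧
    ∀ x : V, Tendsto (fun n : ℕ => (((specRad A)⁻¹ • A) ^ n) x) atTop (𝓝 (⟪y₀, x⟫ • x₀))

/-- `A` is `K`-mixing. -/
def IsMixing (K : Set V) (A : V →L[ℝ] V) : Prop := ∃ x₀ y₀, IsMixingWith K A x₀ y₀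

variable {W : Type*} [NormedAddCommGroup W] [InnerProductSpace ℝ W] [FiniteDimensional ℝ W]

/-- The tensor product cone inside the (abstract) tensor square `W` of `V`. -/
def tensorCone (tmul : V →ₗ[ℝ] V →ₗ[ℝ] W) (K₁ K₂ : Set V) : Set W :=
  {z | ∃ (n : ℕ) (f g : Fin n → V),
    (∀ i, f i ∈ K₁) ∧ (∀ i, g i ∈ K₂) ∧ z = ∑ i, tmul (f i) (g i)}

/-- A Cesaro limit point of a bounded orbit is a fixed point. -/
lemma cesaro_fixed {E : Type*} [NormedAddCommGroup E] [InnerProductSpace ℝ E]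
    [FiniteDimensional ℝ E] (T : E →L[ℝ] E) (w : E) (M : ℝ) (hM : ∀ k : ℕ, ‖(T ^ k) w‖ ≤ M) :
    ∃ (p : E) (φ : ℕ → ℕ), StrictMono φ ∧ T p = p ∧
      Tendsto (fun n => ((φ n : ℝ) + 1)⁻¹ • ∑ k ∈ Finset.range (φ n + 1), (T ^ k) w)
        atTop (𝓝 p) := by
  set C : ℕ → E := fun n => ((n : ℝ) + 1)⁻¹ • ∑ k ∈ Finset.range (n + 1), (T ^ k) w with hC
  have hCb : ∀ n, C n ∈ Metric.closedBall (0 : E) M := by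
    intro n
    rw [mem_closedBall_zero_iff, hC]
    simp only
    have hn : (0 : ℝ) < (n : ℝ) + 1 := by positivity
    rw [norm_smul, norm_inv, Real.norm_of_nonneg hn.le, inv_mul_le_iff₀ hn]
    refine (norm_sum_le_of_le _ (fun k _ => hM k)).trans ?_
    simp
  obtain ⟨p, -, φ, hφ, hp⟩ := (isCompact_closedBall (0 : E) M).tendsto_subseq hCb
  refine ⟨p, φ, hφ, ?_, hp⟩
  have hdiff : ∀ n, T (C n) - C n = ((n : ℝ) + 1)⁻¹ • ((T ^ (n + 1)) w - w) := by
    intro n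
    simp only [hC, map_smul, map_sum, ← smul_sub, ← Finset.sum_sub_distrib]
    congr 1
    have : ∀ k, T ((T ^ k) w) = (T ^ (k + 1)) w := by
      intro k; rw [pow_succ']; rfl
    simp only [this]
    rw [Finset.sum_range_sub (fun k => (T ^ k) w)]
    simp
  have h0 : Tendsto (fun n => T (C n) - C n) atTop (𝓝 0) := by
    rw [tendsto_zero_iff_norm_tendsto_zero]
    have hlim : Tendsto (fun n : ℕ => (1 / ((n : ℝ) + 1)) * (M + M)) atTop (𝓝 0) := by
      simpa using (tendsto_one_div_add_atTop_nhds_zero_nat (𝕜 := ℝ)).mul_const (M + M)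
    refine squeeze_zero (fun _ => norm_nonneg _) (fun n => ?_) hlim
    have hn : (0 : ℝ) < (n : ℝ) + 1 := by positivity
    rw [hdiff, norm_smul, norm_inv, Real.norm_of_nonneg hn.le, one_div]
    gcongr
    refine (norm_sub_le _ _).trans (add_le_add (hM _) ?_)
    simpa using hM 0
  have h1 : Tendsto (fun n => T (C (φ n)) - C (φ n)) atTop (𝓝 (T p - p)) :=
    ((T.continuous.tendsto p).comp hp).sub hp
  have := tendsto_nhds_unique h1 (h0.comp hφ.tendsto_atTop)
  exact sub_eq_zero.mp this

lemma unit_bound (K : Set V) (u : V) (hu : u ∈ interior (dualSet K)) :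
    ∃ c : ℝ, 0 < c ∧ ∀ x ∈ K, c * ‖x‖ ≤ ⟪u, x⟫ := by
  obtain ⟨r, hr, hb⟩ := Metric.isOpen_iff.1 isOpen_interior u hu
  refine ⟨r / 2, by positivity, fun x hx => ?_⟩
  by_cases hx0 : x = 0
  · simp [hx0]
  have hxn : 0 < ‖x‖ := norm_pos_iff.2 hx0
  have hmem : u - (r / 2 * ‖x‖⁻¹) • x ∈ Metric.ball u r := by
    rw [mem_ball_iff_norm, sub_sub_cancel_left, norm_neg, norm_smul, Real.norm_of_nonneg (by positivity),
      mul_assoc, inv_mul_cancel₀ hxn.ne']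
    linarith
  have h := interior_subset (hb hmem) x hx
  rw [inner_sub_left, real_inner_smul_left, real_inner_self_eq_norm_sq] at h
  have : r / 2 * ‖x‖⁻¹ * ‖x‖ ^ 2 = r / 2 * ‖x‖ := by field_simp
  linarith

lemma inner_pow (A : V →L[ℝ] V) (u : V) (hDUP : ContinuousLinearMap.adjoint A u = u)
    (n : ℕ) (x : V) : ⟪u, (A ^ n) x⟫ = ⟪u, x⟫ := by
  induction n with
  | zero => simp
  | succ k ih =>
    have : (A ^ (k + 1)) x = A ((A ^ k) x) := by rw [pow_succ']; rfl
    rw [this, ← ContinuousLinearMap.adjoint_inner_left, hDUP, ih]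

lemma pow_mem_cone (K : Set V) (A : V →L[ℝ] V) (hA : ∀ x ∈ K, A x ∈ K) (n : ℕ) (x : V)
    (hx : x ∈ K) : (A ^ n) x ∈ K := by
  induction n with
  | zero => simpa
  | succ k ih =>
    have : (A ^ (k + 1)) x = A ((A ^ k) x) := by rw [pow_succ']; rfl
    rw [this]; exact hA _ ih

lemma power_bounded (K : Set V)
    (hKint : (interior K).Nonempty)
    (u : V) (hu : u ∈ interior (dualSet K))
    (A : V →L[ℝ] V) (hA : ∀ x ∈ K, A x ∈ K)
    (hDUP : ContinuousLinearMap.adjoint A u = u) :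
    ∃ M : ℝ, 0 < M ∧ ∀ n : ℕ, ‖A ^ n‖ ≤ M := by
  obtain ⟨c, hc, hcK⟩ := unit_bound K u hu
  obtain ⟨e, he⟩ := hKint
  obtain ⟨r, hr, hb⟩ := Metric.isOpen_iff.1 isOpen_interior e he
  have hpos : ∀ n : ℕ, ∀ x ∈ K, ‖(A ^ n) x‖ ≤ c⁻¹ * (‖u‖ * ‖x‖) := by
    intro n x hx
    have h1 := hcK _ (pow_mem_cone K A hA n x hx)
    rw [inner_pow A u hDUP] at h1
    rw [le_inv_mul_iff₀ hc]
    exact h1.trans (real_inner_le_norm _ _)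
  have heK := interior_subset he
  set N : ℝ := c⁻¹ * (‖u‖ * (‖e‖ + r)) with hN
  have hN0 : 0 ≤ N := by positivity
  refine ⟨2 / r * (N + N) + 1, by positivity, fun n => ?_⟩
  suffices ‖A ^ n‖ ≤ 2 / r * (N + N) by linarith
  refine ContinuousLinearMap.opNorm_le_bound _ (by positivity) (fun x => ?_)
  by_cases hx0 : x = 0
  · simp [hx0]
  have hxn : 0 < ‖x‖ := norm_pos_iff.2 hx0
  set t : ℝ := r / 2 * ‖x‖⁻¹ with ht
  have ht0 : 0 < t := by positivity
  have htx : ‖t • x‖ = r / 2 := by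
    rw [norm_smul, Real.norm_of_nonneg ht0.le, ht, mul_assoc, inv_mul_cancel₀ hxn.ne', mul_one]
  have hmem : e + t • x ∈ Metric.ball e r := by
    rw [mem_ball_iff_norm, add_sub_cancel_left, htx]
    linarith
  have h1 := hpos n _ (interior_subset (hb hmem))
  have h2 := hpos n _ heK
  have h1' : ‖(A ^ n) (e + t • x)‖ ≤ N := h1.trans (by
    rw [hN]; gcongr; exact (norm_add_le _ _).trans (by rw [htx]; linarith))
  have h2' : ‖(A ^ n) e‖ ≤ N := h2.trans (by rw [hN]; gcongr; linarith)
  have h3 : t * ‖(A ^ n) x‖ ≤ N + N := by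
    have : (A ^ n) (e + t • x) - (A ^ n) e = t • (A ^ n) x := by
      rw [map_add, map_smul, add_sub_cancel_left]
    rw [← Real.norm_of_nonneg ht0.le, ← norm_smul, ← this]
    exact (norm_sub_le _ _).trans (add_le_add h1' h2')
  have h4 : ‖(A ^ n) x‖ = 2 / r * (t * ‖(A ^ n) x‖) * ‖x‖ := by
    rw [ht]; field_simp
  rw [h4]
  gcongr

lemma exists_pos_cone [Nontrivial V] (K : Set V)
    (hKint : (interior K).Nonempty)
    (u : V) (hu : u ∈ interior (dualSet K)) : ∃ e ∈ K, 0 < ⟪u, e⟫ := by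
  obtain ⟨c, hc, hcK⟩ := unit_bound K u hu
  obtain ⟨e, he, hne⟩ : ∃ e ∈ K, e ≠ 0 := by
    by_contra! h
    have h1 : interior K ⊆ {0} := fun x hx => h x (interior_subset hx)
    obtain ⟨e, he⟩ := hKint
    have h2 : interior ({0} : Set V) = ∅ := interior_singleton 0
    have := interior_maximal h1 isOpen_interior he
    rw [h2] at this
    exact this
  exact ⟨e, he, lt_of_lt_of_le (mul_pos hc (norm_pos_iff.2 hne)) (hcK e he)⟩

lemma specRad_eq_one (A : V →L[ℝ] V) (u : V) (hu0 : u ≠ 0)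
    (hDUP : ContinuousLinearMap.adjoint A u = u) (M : ℝ) (hM0 : 0 < M)
    (hM : ∀ n : ℕ, ‖A ^ n‖ ≤ M) : specRad A = 1 := by
  have hun : 0 < ‖u‖ := norm_pos_iff.2 hu0
  have h1 : ∀ n : ℕ, 1 ≤ ‖A ^ n‖ := by
    intro n
    have h := inner_pow A u hDUP n u
    rw [real_inner_self_eq_norm_sq] at h
    have h2 : ‖u‖ ^ 2 ≤ ‖u‖ * (‖A ^ n‖ * ‖u‖) := by
      rw [← h]
      refine (real_inner_le_norm _ _).trans ?_
      gcongr
      exact (A ^ n).le_opNorm u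
    have h3 : 0 < ‖u‖ ^ 2 := by positivity
    by_contra! h4
    nlinarith
  have hlim : Tendsto (fun n : ℕ => M ^ ((n : ℝ)⁻¹)) atTop (𝓝 1) := by
    have h := (Real.continuousAt_const_rpow (a := M) (b := 0) hM0.ne').tendsto.comp
      (tendsto_inv_atTop_nhds_zero_nat (𝕜 := ℝ))
    rw [Real.rpow_zero] at h
    exact h
  have : Tendsto (fun n : ℕ => ‖A ^ n‖ ^ ((n : ℝ)⁻¹)) atTop (𝓝 1) := by
    refine tendsto_of_tendsto_of_tendsto_of_le_of_le tendsto_const_nhds hlim ?_ ?_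
    · intro n
      exact Real.one_le_rpow (h1 n) (by positivity)
    · intro n
      exact Real.rpow_le_rpow (norm_nonneg _) (hM n) (by positivity)
  exact this.limsup_eq

lemma tmul_norm (tmul : V →ₗ[ℝ] V →ₗ[ℝ] W)
    (hinner : ∀ a c b d : V, ⟪tmul a b, tmul c d⟫ = ⟪a, c⟫ * ⟪b, d⟫) (a b : V) :
    ‖tmul a b‖ = ‖a‖ * ‖b‖ := by
  have h := hinner a a b b
  simp only [real_inner_self_eq_norm_sq] at h
  rw [← mul_pow] at h
  exact (sq_eq_sq₀ (norm_nonneg _) (by positivity)).1 h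

lemma tmul_pow (tmul : V →ₗ[ℝ] V →ₗ[ℝ] W) (A : V →L[ℝ] V)
    (B : W →L[ℝ] W) (hB : ∀ a b : V, B (tmul a b) = tmul (A a) (A b)) (n : ℕ) (a b : V) :
    (B ^ n) (tmul a b) = tmul ((A ^ n) a) ((A ^ n) b) := by
  induction n with
  | zero => simp
  | succ k ih =>
    have h1 : ∀ x, (A ^ (k + 1)) x = A ((A ^ k) x) := by intro x; rw [pow_succ']; rfl
    have h2 : ∀ x, (B ^ (k + 1)) x = B ((B ^ k) x) := by intro x; rw [pow_succ']; rfl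
    rw [h1, h1, h2, ih, hB]

lemma tmul_tendsto (tmul : V →ₗ[ℝ] V →ₗ[ℝ] W) (f g : ℕ → V) (a b : V)
    (hf : Tendsto f atTop (𝓝 a)) (hg : Tendsto g atTop (𝓝 b)) :
    Tendsto (fun n => tmul (f n) (g n)) atTop (𝓝 (tmul a b)) := by
  let T : V →ₗ[ℝ] (V →L[ℝ] W) := LinearMap.toContinuousLinearMap.toLinearMap ∘ₗ tmul
  have hT : Continuous T := T.continuous_of_finiteDimensional
  have hc : Continuous fun q : (V →L[ℝ] W) × V => q.1 q.2 := by fun_prop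
  exact (hc.tendsto (T a, b)).comp (((hT.tendsto a).comp hf).prodMk_nhds hg)

/-- The key step of the converse. -/
lemma orbit_tendsto_zero (u : V) (tmul : V →ₗ[ℝ] V →ₗ[ℝ] W)
    (hinner : ∀ a c b d : V, ⟪tmul a b, tmul c d⟫ = ⟪a, c⟫ * ⟪b, d⟫)
    (A : V →L[ℝ] V) (hDUP : ContinuousLinearMap.adjoint A u = u)
    (B : W →L[ℝ] W) (hB : ∀ a b : V, B (tmul a b) = tmul (A a) (A b))
    (M : ℝ) (hM0 : 0 < M) (hM : ∀ n : ℕ, ‖A ^ n‖ ≤ M)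
    (x₀ : V) (hx₀ : ⟪u, x₀⟫ = 1)
    (hker : ∀ w, B w = w → ∃ c : ℝ, w = c • tmul x₀ x₀)
    (x : V) (hx : ⟪u, x⟫ = 0) : Tendsto (fun n => (A ^ n) x) atTop (𝓝 0) := by
  have hbd : ∀ k : ℕ, ‖(B ^ k) (tmul x x)‖ ≤ (M * ‖x‖) * (M * ‖x‖) := by
    intro k
    rw [tmul_pow tmul A B hB, tmul_norm tmul hinner]
    have := (A ^ k).le_of_opNorm_le (hM k) x
    gcongr
  obtain ⟨p, φ, hφ, hp, hlim⟩ := cesaro_fixed B (tmul x x) _ hbd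
  obtain ⟨c, rfl⟩ := hker p hp
  have hc : c = 0 := by
    have h1 := (tendsto_const_nhds (x := tmul u u)).inner (𝕜 := ℝ) hlim
    have h2 : ∀ n, ⟪tmul u u, ((φ n : ℝ) + 1)⁻¹ •
        ∑ k ∈ Finset.range (φ n + 1), (B ^ k) (tmul x x)⟫ = 0 := by
      intro n
      simp only [inner_smul_right, inner_sum, tmul_pow tmul A B hB, hinner, inner_pow A u hDUP, hx,
        mul_zero, Finset.sum_const_zero]
    simp only [h2] at h1
    have h3 := tendsto_nhds_unique h1 tendsto_const_nhds
    rw [inner_smul_right, hinner, hx₀] at h3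
    linarith
  rw [hc, zero_smul] at hlim
  let b := stdOrthonormalBasis ℝ V
  have htr : ∀ a : V, ⟪∑ i, tmul (b i) (b i), tmul a a⟫ = ‖a‖ ^ 2 := by
    intro a
    rw [sum_inner, ← b.sum_sq_norm_inner_right a]
    refine Finset.sum_congr rfl (fun i _ => ?_)
    rw [hinner, Real.norm_eq_abs, sq_abs, sq]
  have h1 := (tendsto_const_nhds (x := ∑ i, tmul (b i) (b i))).inner (𝕜 := ℝ) hlim
  simp only [inner_smul_right, inner_sum, tmul_pow tmul A B hB, htr, inner_zero_right] at h1
  rw [Metric.tendsto_atTop]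
  intro ε hε
  obtain ⟨n, hn⟩ := (h1.eventually (gt_mem_nhds (show (0 : ℝ) < (ε / M) ^ 2 by positivity))).exists
  have hn0 : (0 : ℝ) < (φ n : ℝ) + 1 := by positivity
  obtain ⟨k, hk⟩ : ∃ k : ℕ, ‖(A ^ k) x‖ ^ 2 < (ε / M) ^ 2 := by
    by_contra! h
    rw [inv_mul_lt_iff₀ hn0] at hn
    have := Finset.card_nsmul_le_sum (Finset.range (φ n + 1)) (fun k => ‖(A ^ k) x‖ ^ 2) _
      (fun k _ => h k)
    simp at this
    simp at hn
    linarith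
  have hk' : ‖(A ^ k) x‖ < ε / M := lt_of_pow_lt_pow_left₀ 2 (by positivity) hk
  refine ⟨k, fun m hm => ?_⟩
  obtain ⟨j, rfl⟩ := Nat.exists_eq_add_of_le hm
  rw [dist_zero_right, add_comm, pow_add]
  have := (A ^ j).le_of_opNorm_le (hM j) ((A ^ k) x)
  refine lt_of_le_of_lt this ?_
  rwa [lt_div_iff₀' hM0] at hk'

theorem stmt_9 (K : Set V) (hKcl : IsClosed K) (hKconv : Convex ℝ K)
    (hKcone : ∀ c : ℝ, 0 ≤ c → ∀ x ∈ K, c • x ∈ K)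
    (hKint : (interior K).Nonempty) (hKpt : K ∩ (-K) = {(0 : V)})
    (u : V) (hu : u ∈ interior (dualSet K))
    (tmul : V →ₗ[ℝ] V →ₗ[ℝ] W)
    (hinner : ∀ a c b d : V, ⟪tmul a b, tmul c d⟫ = ⟪a, c⟫ * ⟪b, d⟫)
    (hspan : Submodule.span ℝ {z : W | ∃ a b, z = tmul a b} = ⊤)
    (A : V →L[ℝ] V) (hA : ∀ x ∈ K, A x ∈ K)
    (hDUP : ContinuousLinearMap.adjoint A u = u)
    (B : W →L[ℝ] W) (hB : ∀ a b : V, B (tmul a b) = tmul (A a) (A b)) :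
    IsMixing K A ↔
      Module.finrank ℝ (LinearMap.ker ((B : W →ₗ[ℝ] W) - LinearMap.id)) = 1 := by
  obtain ⟨M, hM0, hM⟩ := power_bounded K hKint u hu A hA hDUP
  have hkmem : ∀ w, w ∈ LinearMap.ker ((B : W →ₗ[ℝ] W) - LinearMap.id) ↔ B w = w := by
    intro w
    simp [LinearMap.mem_ker, sub_eq_zero]
  constructor
  · rintro ⟨x₀, y₀, -, hx₀, hy₀, hxy, hlim⟩
    have hx0 : x₀ ≠ 0 := by rintro rfl; simp at hxy
    haveI : Nontrivial V := ⟨x₀, 0, hx0⟩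
    obtain ⟨e, -, hue⟩ := exists_pos_cone K hKint u hu
    have hu0 : u ≠ 0 := by rintro rfl; simp at hue
    rw [specRad_eq_one A u hu0 hDUP M hM0 hM] at hlim
    simp only [inv_one, one_smul] at hlim
    have hfix : A x₀ = x₀ := by
      have h1 := hlim x₀
      rw [hxy, one_smul] at h1
      have h2 := (A.continuous.tendsto x₀).comp h1
      have h3 := (tendsto_add_atTop_iff_nat 1).2 h1
      refine tendsto_nhds_unique h2 (h3.congr fun n => ?_)
      rw [pow_succ']; rfl
    have hne : tmul x₀ x₀ ≠ 0 := by
      rw [← norm_ne_zero_iff, tmul_norm tmul hinner]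
      have := norm_ne_zero_iff.2 hx0
      positivity
    have hall : ∀ w : W, ∃ c : ℝ, Tendsto (fun n : ℕ => (B ^ n) w) atTop
        (𝓝 (c • tmul x₀ x₀)) := by
      intro w
      have hw : w ∈ Submodule.span ℝ {z : W | ∃ a b, z = tmul a b} := by rw [hspan]; trivial
      induction hw using Submodule.span_induction with
      | mem z hz =>
        obtain ⟨a, b, rfl⟩ := hz
        refine ⟨⟪y₀, a⟫ * ⟪y₀, b⟫, ?_⟩
        simp only [tmul_pow tmul A B hB]
        have := tmul_tendsto tmul _ _ _ _ (hlim a) (hlim b)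
        simpa [smul_smul, mul_comm] using this
      | zero => exact ⟨0, by simp⟩
      | add x y _ _ hx hy =>
        obtain ⟨c, hc⟩ := hx
        obtain ⟨d, hd⟩ := hy
        refine ⟨c + d, ?_⟩
        simpa [add_smul] using hc.add hd
      | smul a x _ hx =>
        obtain ⟨c, hc⟩ := hx
        refine ⟨a * c, ?_⟩
        simpa [mul_smul] using hc.const_smul a
    refine finrank_eq_one (⟨tmul x₀ x₀, (hkmem _).2 (by rw [hB, hfix])⟩ :
      LinearMap.ker ((B : W →ₗ[ℝ] W) - LinearMap.id)) ?_ ?_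
    · intro h; exact hne (congrArg Subtype.val h)
    · rintro ⟨w, hw⟩
      obtain ⟨c, hc⟩ := hall w
      refine ⟨c, Subtype.ext ?_⟩
      have hBw := (hkmem w).1 hw
      have hpow : ∀ n : ℕ, (B ^ n) w = w := by
        intro n
        induction n with
        | zero => simp
        | succ k ih =>
          have : (B ^ (k + 1)) w = B ((B ^ k) w) := by rw [pow_succ']; rfl
          rw [this, ih, hBw]
      simp only [hpow] at hc
      exact tendsto_nhds_unique hc tendsto_const_nhds
  · intro hdim
    haveI : Nontrivial V := by
      by_contra hV
      rw [not_nontrivial_iff_subsingleton] at hV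
      have hbot : (⊤ : Submodule ℝ W) = ⊥ := by
        rw [← hspan, Submodule.span_eq_bot]
        rintro z ⟨a, b, rfl⟩
        rw [Subsingleton.elim a 0]; simp
      have hz : LinearMap.ker ((B : W →ₗ[ℝ] W) - LinearMap.id) = ⊥ :=
        le_bot_iff.1 (hbot ▸ le_top)
      rw [hz] at hdim
      simp at hdim
    obtain ⟨e, heK, hue⟩ := exists_pos_cone K hKint u hu
    have hu0 : u ≠ 0 := by rintro rfl; simp at hue
    have hsr := specRad_eq_one A u hu0 hDUP M hM0 hM
    obtain ⟨p, φ, hφ, hp, hplim⟩ := cesaro_fixed A e (M * ‖e‖)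
      (fun k => (A ^ k).le_of_opNorm_le (hM k) e)
    have hadd : ∀ x ∈ K, ∀ y ∈ K, x + y ∈ K := by
      intro x hx y hy
      have h := hKcone 2 (by norm_num) _ (hKconv hx hy (a := 1 / 2) (b := 1 / 2)
        (by norm_num) (by norm_num) (by norm_num))
      simpa [smul_smul] using h
    have h0K : (0 : V) ∈ K := by simpa using hKcone 0 le_rfl e heK
    have hpK : p ∈ K := by
      refine hKcl.mem_of_tendsto hplim (Eventually.of_forall fun n => ?_)
      refine hKcone _ (by positivity) _ ?_
      refine Finset.sum_induction _ (· ∈ K) (fun x y hx hy => hadd x hx y hy) h0K ?_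
      intro k _
      exact pow_mem_cone K A hA k e heK
    have hup : ⟪u, p⟫ = ⟪u, e⟫ := by
      have h1 := (tendsto_const_nhds (x := u)).inner (𝕜 := ℝ) hplim
      have h2 : ∀ n, ⟪u, ((φ n : ℝ) + 1)⁻¹ •
          ∑ k ∈ Finset.range (φ n + 1), (A ^ k) e⟫ = ⟪u, e⟫ := by
        intro n
        have hn0 : ((φ n : ℝ) + 1) ≠ 0 := by positivity
        simp only [inner_smul_right, inner_sum, inner_pow A u hDUP, Finset.sum_const,
          Finset.card_range, nsmul_eq_mul]
        push_cast
        field_simp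
      simp only [h2] at h1
      exact (tendsto_nhds_unique h1 tendsto_const_nhds)
    set x₀ : V := (⟪u, e⟫)⁻¹ • p with hx₀def
    have hux : ⟪u, x₀⟫ = 1 := by
      rw [hx₀def, inner_smul_right, hup, inv_mul_cancel₀ hue.ne']
    have hAx : A x₀ = x₀ := by rw [hx₀def, map_smul, hp]
    have hx₀K : x₀ ∈ K := hKcone _ (by positivity) _ hpK
    have hx0 : x₀ ≠ 0 := by intro h; rw [h] at hux; simp at hux
    have hne : tmul x₀ x₀ ≠ 0 := by
      rw [← norm_ne_zero_iff, tmul_norm tmul hinner]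
      have := norm_ne_zero_iff.2 hx0
      positivity
    have hker : ∀ w, B w = w → ∃ c : ℝ, w = c • tmul x₀ x₀ := by
      intro w hw
      have hnz : (⟨tmul x₀ x₀, (hkmem _).2 (by rw [hB, hAx])⟩ :
        LinearMap.ker ((B : W →ₗ[ℝ] W) - LinearMap.id)) ≠ 0 :=
        fun h => hne (congrArg Subtype.val h)
      obtain ⟨c, hc⟩ := (finrank_eq_one_iff_of_nonzero' _ hnz).1 hdim ⟨w, (hkmem w).2 hw⟩
      exact ⟨c, (congrArg Subtype.val hc).symm⟩
    refine ⟨x₀, u, by rw [hsr]; norm_num, hx₀K, interior_subset hu, hux, fun x => ?_⟩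
    rw [hsr]
    simp only [inv_one, one_smul]
    have h1 := orbit_tendsto_zero u tmul hinner A hDUP B hB M hM0 hM x₀ hux hker
      (x - ⟪u, x⟫ • x₀) (by rw [inner_sub_right, inner_smul_right, hux]; ring)
    have hpow : ∀ n : ℕ, (A ^ n) x₀ = x₀ := by
      intro n
      induction n with
      | zero => simp
      | succ k ih =>
        have : (A ^ (k + 1)) x₀ = A ((A ^ k) x₀) := by rw [pow_succ']; rfl
        rw [this, ih, hAx]
    simp only [map_sub, map_smul, hpow] at h1
    simpa using h1.add_const (⟪u, x⟫ • x₀)
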